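/- For a fixed integer matrix A and rational cost vector c, there exists a constant C (depending only on A and c) such that for every right-hand side b ∈ ℤ^d for which the integer program min{c·u : Au = b, u ∈ ℕ^n} is feasible and bounded, the difference between the optimal value of the integer program and the optimal value of its LP relaxation is at most C. -/

import Mathlib

lemma exists_rat_sign {d n : ℕ} (A : Matrix (Fin d) (Fin n) ℤ) (w : Fin n → ℝ)
    (hw : ∀ k, ∑ i, (A k i : ℝ) * w i = 0) :
    ∃ g : Fin n → ℚ, (∀ k, ∑ i, (A k i : ℚ) * g i = 0) ∧
      ∀ i, SignType.sign (g i : ℝ) = SignType.sign (w i) := by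
  classical
  let V := Submodule.span ℚ (Set.range w)
  haveI : Module.Finite ℚ V := Module.Finite.span_of_finite ℚ (Set.finite_range w)
  let B := Module.finBasis ℚ V
  let W : Fin n → V := fun i => ⟨w i, Submodule.subset_span ⟨i, rfl⟩⟩
  have hWA : ∀ k, ∑ i, (A k i : ℚ) • W i = 0 := by
    intro k
    apply Subtype.ext
    simpa [W, Rat.smul_def] using hw k
  have hrep : ∀ i, w i = ∑ j, (B.repr (W i) j : ℝ) * (B j : ℝ) := by
    intro i
    have h := congrArg (Subtype.val) (B.sum_repr (W i))
    simp only [Submodule.coe_sum, Submodule.coe_smul, Rat.smul_def] at h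
    exact h.symm
  let S : Set (Fin (Module.finrank ℚ V) → ℝ) :=
    {x | ∀ i, w i ≠ 0 → 0 < w i * ∑ j, (B.repr (W i) j : ℝ) * x j}
  have hS : IsOpen S := by
    simp only [S, Set.setOf_forall]
    refine isOpen_iInter_of_finite fun i => isOpen_iInter_of_finite fun _ => ?_
    exact isOpen_lt (by fun_prop) (by fun_prop)
  have hne : S.Nonempty := by
    refine ⟨fun j => (B j : ℝ), fun i hi => ?_⟩
    rw [← hrep i]
    exact mul_self_pos.2 hi
  have hd : DenseRange (Pi.map (fun (_ : Fin (Module.finrank ℚ V)) (q : ℚ) => (q : ℝ))) :=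
    DenseRange.piMap fun _ => Rat.denseRange_cast
  obtain ⟨e, he⟩ := hd.exists_mem_open hS hne
  let φ : V →ₗ[ℚ] ℚ := B.constr ℚ e
  refine ⟨fun i => φ (W i), fun k => ?_, fun i => ?_⟩
  · have h := congrArg φ (hWA k)
    simpa using h
  · by_cases hi : w i = 0
    · have : W i = 0 := Subtype.ext hi
      simp [this, hi]
    · have h := he i hi
      have h2 : ((φ (W i) : ℚ) : ℝ) = ∑ j, (B.repr (W i) j : ℝ) * (e j : ℝ) := by
        simp [φ, Module.Basis.constr_apply_fintype]
      simp only [Pi.map_apply] at h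
      rw [← h2] at h
      rcases pos_and_pos_or_neg_and_neg_of_mul_pos h with ⟨a, b⟩ | ⟨a, b⟩
      · rw [sign_pos a, sign_pos b]
      · rw [sign_neg a, sign_neg b]

lemma exists_int_sign {d n : ℕ} (A : Matrix (Fin d) (Fin n) ℤ) (w : Fin n → ℝ)
    (hw : ∀ k, ∑ i, (A k i : ℝ) * w i = 0) :
    ∃ g : Fin n → ℤ, (∀ k, ∑ i, A k i * g i = 0) ∧
      ∀ i, SignType.sign (g i : ℝ) = SignType.sign (w i) := by
  classical
  obtain ⟨q, hq, hs⟩ := exists_rat_sign A w hw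
  let N : ℕ := ∏ i, (q i).den
  have hN : 0 < N := Finset.prod_pos fun i _ => (q i).den_pos
  have hex : ∀ i, ∃ z : ℤ, (z : ℚ) = N * q i := by
    intro i
    obtain ⟨m, hm⟩ : (q i).den ∣ N := Finset.dvd_prod_of_mem _ (Finset.mem_univ i)
    refine ⟨m * (q i).num, ?_⟩
    rw [hm]
    push_cast
    have := Rat.mul_den_eq_num (q i)
    rw [← this]
    ring
  choose g hg using hex
  refine ⟨g, fun k => ?_, fun i => ?_⟩
  · have : ((∑ i, A k i * g i : ℤ) : ℚ) = 0 := by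
      push_cast
      simp only [hg]
      calc _ = (N : ℚ) * ∑ i, (A k i : ℚ) * q i := by
            rw [Finset.mul_sum]
            exact Finset.sum_congr rfl fun i _ => by ring
        _ = 0 := by rw [hq k, mul_zero]
    exact_mod_cast this
  · have h : (g i : ℝ) = N * (q i : ℝ) := by exact_mod_cast congrArg (Rat.cast : ℚ → ℝ) (hg i)
    rw [h, sign_mul, sign_pos (by exact_mod_cast hN), one_mul, hs]

lemma exists_choice {d n : ℕ} (A : Matrix (Fin d) (Fin n) ℤ) :
    ∃ g : (Fin n → SignType) → Fin n → ℤ, ∀ w : Fin n → ℝ,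
      (∀ k, ∑ i, (A k i : ℝ) * w i = 0) →
      (∀ k, ∑ i, A k i * g (fun i => SignType.sign (w i)) i = 0) ∧
      ∀ i, SignType.sign (g (fun i => SignType.sign (w i)) i : ℝ) = SignType.sign (w i) := by
  classical
  have : ∀ s : Fin n → SignType, ∃ g : Fin n → ℤ, ∀ w : Fin n → ℝ,
      (∀ k, ∑ i, (A k i : ℝ) * w i = 0) → (fun i => SignType.sign (w i)) = s →
      (∀ k, ∑ i, A k i * g i = 0) ∧ ∀ i, SignType.sign (g i : ℝ) = s i := by
    intro s
    by_cases h : ∃ w : Fin n → ℝ, (∀ k, ∑ i, (A k i : ℝ) * w i = 0) ∧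
      (fun i => SignType.sign (w i)) = s
    · obtain ⟨w, hw, rfl⟩ := h
      obtain ⟨g, h1, h2⟩ := exists_int_sign A w hw
      exact ⟨g, fun _ _ _ => ⟨h1, h2⟩⟩
    · exact ⟨0, fun w hw hs => (h ⟨w, hw, hs⟩).elim⟩
  choose g hg using this
  exact ⟨g, fun w hw => hg _ w hw rfl⟩

lemma round_aux {d n : ℕ} (A : Matrix (Fin d) (Fin n) ℤ) (c : Fin n → ℝ) :
    ∃ M : ℝ, 0 ≤ M ∧ ∀ (k : ℕ) (u : Fin n → ℤ) (v : Fin n → ℝ), (∀ i, 0 ≤ u i) → (∀ i, 0 ≤ v i) →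
      (∀ r, ∑ i, (A r i : ℝ) * (v i - u i) = 0) →
      (Finset.univ.filter (fun i => v i - u i ≠ 0)).card ≤ k →
      ∃ u' : Fin n → ℤ, (∀ i, 0 ≤ u' i) ∧ (∀ r, ∑ i, A r i * u' i = ∑ i, A r i * u i) ∧
        ∑ i, c i * u' i ≤ ∑ i, c i * v i + k * M := by
  classical
  obtain ⟨g, hg⟩ := exists_choice A
  refine ⟨∑ s, |∑ i, c i * (g s i : ℝ)|, Finset.sum_nonneg fun _ _ => abs_nonneg _, ?_⟩
  set M := ∑ s, |∑ i, c i * (g s i : ℝ)| with hM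
  have hM0 : 0 ≤ M := Finset.sum_nonneg fun _ _ => abs_nonneg _
  intro k
  induction k with
  | zero =>
    intro u v hu hv hA hk
    refine ⟨u, hu, fun _ => rfl, ?_⟩
    have : ∀ i, v i = u i := by
      intro i
      by_contra hi
      have := Finset.card_eq_zero.1 (Nat.le_zero.1 hk)
      have h2 : i ∈ Finset.univ.filter (fun i => v i - u i ≠ 0) := by
        simpa [sub_eq_zero] using hi
      rw [this] at h2
      simp at h2
    simp [this]
  | succ k ih =>
    intro u v hu hv hA hk
    by_cases hne : (Finset.univ.filter (fun i => v i - u i ≠ 0)).Nonempty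
    swap
    · rw [Finset.not_nonempty_iff_eq_empty] at hne
      obtain ⟨u', h1, h2, h3⟩ := ih u v hu hv hA (by rw [hne]; simp)
      refine ⟨u', h1, h2, h3.trans ?_⟩
      push_cast
      linarith
    obtain ⟨hgA, hgs⟩ := hg (fun i => v i - u i) hA
    set s : Fin n → SignType := fun i => SignType.sign (v i - u i) with hs
    set G := g s with hG
    obtain ⟨i0, hi0, hmin⟩ := Finset.exists_min_image _ (fun i => (v i - u i) / (G i : ℝ)) hne
    set t := (v i0 - u i0) / (G i0 : ℝ) with ht
    have hi0' : v i0 - u i0 ≠ 0 := by simpa using hi0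
    have hzero : ∀ i, v i - u i = 0 → (G i : ℝ) = 0 := by
      intro i hi
      have := hgs i
      rw [hi, sign_zero] at this
      exact sign_eq_zero_iff.1 this
    have hpos : ∀ i, 0 < v i - u i → (0 : ℝ) < G i := by
      intro i hi
      have := hgs i
      rw [sign_pos hi] at this
      exact sign_eq_one_iff.1 this
    have hneg : ∀ i, v i - u i < 0 → (G i : ℝ) < 0 := by
      intro i hi
      have := hgs i
      rw [sign_neg hi] at this
      exact sign_eq_neg_one_iff.1 this
    have ht0 : 0 < t := by
      rcases lt_or_gt_of_ne hi0' with h | h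
      · exact div_pos_of_neg_of_neg h (hneg _ h)
      · exact div_pos h (hpos _ h)
    have hGi0 : (G i0 : ℝ) ≠ 0 := by
      rcases lt_or_gt_of_ne hi0' with h | h
      · exact (hneg _ h).ne
      · exact (hpos _ h).ne'
    have hte : t * G i0 = v i0 - u i0 := div_mul_cancel₀ _ hGi0
    have hf0 : (0 : ℝ) ≤ ⌊t⌋ := by exact_mod_cast Int.floor_nonneg.2 ht0.le
    have hft : (⌊t⌋ : ℝ) ≤ t := Int.floor_le t
    have hft1 : t - ⌊t⌋ ≤ 1 := by linarith [Int.lt_floor_add_one t]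
    have huR : ∀ i, (0 : ℝ) ≤ u i := fun i => by exact_mod_cast hu i
    have key : ∀ i, (0 : ℝ) ≤ u i + ⌊t⌋ * G i ∧ 0 ≤ v i - (t - ⌊t⌋) * G i := by
      intro i
      rcases lt_trichotomy (v i - u i) 0 with h | h | h
      · have h1 := hneg i h
        have h2 := hmin i (by simpa using h.ne)
        rw [le_div_iff_of_neg h1] at h2
        constructor
        · nlinarith [hv i]
        · nlinarith [hv i]
      · rw [hzero i h]
        simpa using ⟨hu i, hv i⟩
      · have h1 := hpos i h
        have h2 := hmin i (by simpa using h.ne')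
        rw [le_div_iff₀ h1] at h2
        constructor
        · nlinarith [huR i, mul_nonneg hf0 h1.le]
        · nlinarith [huR i, mul_nonneg hf0 h1.le]
    have hGA : ∀ r, ∑ i, (A r i : ℝ) * G i = 0 := fun r => by exact_mod_cast hgA r
    have hdiff : ∀ i, (v i - (t - ⌊t⌋) * G i) - ((u i + ⌊t⌋ * G i : ℤ) : ℝ)
        = (v i - u i) - t * G i := by
      intro i; push_cast; ring
    obtain ⟨u', h1, h2, h3⟩ := ih (fun i => u i + ⌊t⌋ * G i) (fun i => v i - (t - ⌊t⌋) * G i)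
      (fun i => by exact_mod_cast (key i).1) (fun i => (key i).2)
      (by
        intro r
        simp only [hdiff, mul_sub]
        have e1 := hA r
        simp only [mul_sub] at e1
        rw [Finset.sum_sub_distrib, e1]
        have : ∑ i, (A r i : ℝ) * (t * G i) = t * ∑ i, (A r i : ℝ) * G i := by
          rw [Finset.mul_sum]; exact Finset.sum_congr rfl fun i _ => by ring
        rw [this, hGA]; simp)
      (by
        simp only [hdiff]
        have : Finset.univ.filter (fun i => (v i - u i) - t * G i ≠ 0) ⊂
            Finset.univ.filter (fun i => v i - u i ≠ 0) := by
          rw [Finset.ssubset_iff_of_subset]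
          · exact ⟨i0, hi0, by simp [hte]⟩
          · intro i hi
            simp only [Finset.mem_filter, Finset.mem_univ, true_and] at hi ⊢
            intro h
            apply hi
            rw [h, hzero i h]; simp
        have := Finset.card_lt_card this
        omega)
    refine ⟨u', h1, fun r => ?_, h3.trans ?_⟩
    · rw [h2 r]
      simp only [mul_add, Finset.sum_add_distrib]
      have : ∑ i, A r i * (⌊t⌋ * G i) = ⌊t⌋ * ∑ i, A r i * G i := by
        rw [Finset.mul_sum]; exact Finset.sum_congr rfl fun i _ => by ring
      rw [this, hgA r]; simp
    · have e : ∑ i, c i * (v i - (t - ⌊t⌋) * G i)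
          = ∑ i, c i * v i - (t - ⌊t⌋) * ∑ i, c i * (G i : ℝ) := by
        rw [Finset.mul_sum, ← Finset.sum_sub_distrib]
        exact Finset.sum_congr rfl fun i _ => by ring
      rw [e]
      have hle : |∑ i, c i * (G i : ℝ)| ≤ M :=
        Finset.single_le_sum (f := fun s => |∑ i, c i * (g s i : ℝ)|)
          (fun _ _ => abs_nonneg _) (Finset.mem_univ s)
      have h5 : |(t - ⌊t⌋) * ∑ i, c i * (G i : ℝ)| ≤ M := by
        rw [abs_mul, abs_of_nonneg (sub_nonneg.2 hft)]
        exact (mul_le_of_le_one_left (abs_nonneg _) hft1).trans hle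
      have := (abs_le.1 h5).1
      push_cast
      linarith


/-- For fixed integer matrix `A` and rational cost `c`, there is a constant `C`
such that for every right-hand side `b` for which the IP is feasible and bounded, the
difference between the IP optimal value and the LP optimal value is at most `C`. -/
theorem stmt1 (d n : ℕ) (A : Matrix (Fin d) (Fin n) ℤ) (c : Fin n → ℚ) :
    ∃ C : ℝ, ∀ b : Fin d → ℤ,
      {x : ℝ | ∃ u : Fin n → ℕ, A.mulVec (fun i => (u i : ℤ)) = b ∧
          x = ∑ i, (c i : ℝ) * (u i : ℝ)}.Nonempty →
      BddBelow {x : ℝ | ∃ u : Fin n → ℕ, A.mulVec (fun i => (u i : ℤ)) = b ∧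
          x = ∑ i, (c i : ℝ) * (u i : ℝ)} →
      sInf {x : ℝ | ∃ u : Fin n → ℕ, A.mulVec (fun i => (u i : ℤ)) = b ∧
          x = ∑ i, (c i : ℝ) * (u i : ℝ)} -
      sInf {x : ℝ | ∃ v : Fin n → ℝ, (∀ i, 0 ≤ v i) ∧
          (A.map (Int.cast : ℤ → ℝ)).mulVec v = (fun i => (b i : ℝ)) ∧
          x = ∑ i, (c i : ℝ) * v i} ≤ C := by

  obtain ⟨M, hM0, hM⟩ := round_aux A (fun i => (c i : ℝ))
  refine ⟨n * M, fun b hne hbdd => ?_⟩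
  obtain ⟨_, u0, hu0, -⟩ := hne
  have hu0R : ∀ r, ∑ i, (A r i : ℝ) * (u0 i : ℝ) = b r := by
    intro r
    have := congrFun hu0 r
    simp only [Matrix.mulVec, dotProduct] at this
    exact_mod_cast this
  rw [sub_le_comm]
  apply le_csInf
  · exact ⟨_, fun i => (u0 i : ℝ), fun i => Nat.cast_nonneg _, by
      funext r
      simpa [Matrix.mulVec, dotProduct] using hu0R r, rfl⟩
  · rintro _ ⟨v, hv, hvA, rfl⟩
    obtain ⟨u', h1, h2, h3⟩ := hM n (fun i => (u0 i : ℤ)) v (fun i => by positivity) hv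
      (by
        intro r
        have := congrFun hvA r
        simp only [Matrix.mulVec, dotProduct, Matrix.map_apply] at this
        simp only [mul_sub, Finset.sum_sub_distrib, this, Int.cast_natCast, hu0R, sub_self])
      ((Finset.card_le_univ _).trans (by simp))
    have hcast : ∀ i, (((u' i).toNat : ℕ) : ℤ) = u' i := fun i => Int.toNat_of_nonneg (h1 i)
    have hcastR : ∀ i, (((u' i).toNat : ℕ) : ℝ) = u' i := fun i => by exact_mod_cast hcast i
    rw [sub_le_iff_le_add]
    refine le_trans (csInf_le hbdd ⟨fun i => (u' i).toNat, ?_, rfl⟩) ?_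
    · rw [← hu0]
      funext r
      simp only [Matrix.mulVec, dotProduct, hcast]
      exact h2 r
    · simpa only [hcastR] using h3
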